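/- arXiv:2009.10749 — 4 statements merged into one kernel-verified Lean document; each statement's English description precedes it below -/
import Mathlib

section
/- (Max Representation) Let d be a positive integer, ζ, η ∈ ℝ^d, and C > 0 such that |ζ_l − η_l| ≤ C for all l ∈ {1,…,d}. Let α := max(ζ, η) componentwise, and let P be the set of pairs (α̃, β) with α̃ ∈ ℝ^d and β ∈ {0,1}^d satisfying: α̃ ≥ η, α̃ ≤ η + Cβ, α̃ ≥ ζ, and α̃ ≤ ζ + C(1_d − β) (all inequalities componentwise). Then P is nonempty, and every (α̃, β) ∈ P satisfies α̃ = α. -/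
/-- Max Representation: the polytope defined by the linear constraints
(with binary β) is nonempty and every element has α̃ = max(ζ, η) componentwise. -/
theorem max_representation (d : ℕ) (hd : 0 < d) (ζ η : Fin d → ℝ)
    (C : ℝ) (hC : 0 < C) (hbound : ∀ l, |ζ l - η l| ≤ C) :
    ((∃ (α : Fin d → ℝ) (β : Fin d → ℝ), (∀ l, β l = 0 ∨ β l = 1) ∧
        (∀ l, η l ≤ α l) ∧ (∀ l, α l ≤ η l + C * β l) ∧
        (∀ l, ζ l ≤ α l) ∧ (∀ l, α l ≤ ζ l + C * (1 - β l))) ∧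
      (∀ (α : Fin d → ℝ) (β : Fin d → ℝ), (∀ l, β l = 0 ∨ β l = 1) →
        (∀ l, η l ≤ α l) → (∀ l, α l ≤ η l + C * β l) →
        (∀ l, ζ l ≤ α l) → (∀ l, α l ≤ ζ l + C * (1 - β l)) →
        ∀ l, α l = max (ζ l) (η l))) := by
  refine ⟨⟨fun l => max (ζ l) (η l), fun l => if η l ≤ ζ l then 1 else 0, fun l => ?_,
    fun l => le_max_right _ _, fun l => ?_, fun l => le_max_left _ _, fun l => ?_⟩, ?_⟩
  · dsimp only
    split_ifs <;> simp
  · have hl := abs_le.mp (hbound l)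
    dsimp only
    split_ifs with h
    · rw [max_eq_left h]
      linarith
    · rw [max_eq_right (not_le.mp h).le]
      linarith
  · have hl := abs_le.mp (hbound l)
    dsimp only
    split_ifs with h
    · rw [max_eq_left h]
      linarith
    · rw [max_eq_right (not_le.mp h).le]
      linarith
  · intro α β hβ hη hηC hζ hζC l
    refine le_antisymm ?_ (max_le (hζ l) (hη l))
    have h₁ := hηC l
    have h₂ := hζC l
    rcases hβ l with h | h <;> rw [h] at h₁ h₂
    · exact le_max_of_le_right (by linarith)
    · exact le_max_of_le_left (by linarith)
end

section
/- (WHT-based MIP) Let n, m, k be positive integers. For each bidder i ∈ {1,…,n}, let S_i = {y_i^(1),…,y_i^(k)} ⊆ {0,1}^m, φ_i ∈ ℝ^k, W_i ∈ {0,1}^{k×m} with rows (y_i^(l))^T, and define ṽ_i(x) = ⟨φ_i, (−1)^{W_i x}⟩ for x ∈ {0,1}^m, where (−1)^{W_i x} is taken componentwise. Then: (i) for every feasible allocation a ∈ F there exist α_i ∈ ℝ^k, β_i ∈ {0,1}^k, and γ_i ∈ ℤ^k (i = 1,…,n) satisfying α_i = −2β_i + 1_k and β_i = W_i a_i − 2γ_i;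 (ii) every such (α_i, β_i, γ_i) satisfies ⟨φ_i, α_i⟩ = ṽ_i(a_i) for all i; and consequently (iii) an allocation a ∈ F maximizes Σ_{i=1}^n ṽ_i(a_i) over F if and only if there exist (α, β, γ) satisfying the above constraints such that (a, α, β, γ) maximizes Σ_{i=1}^n ⟨φ_i, α_i⟩ over all (a', α', β', γ') with a' ∈ F satisfying the constraints. -/
open Matrix

noncomputable section

/-- Integer indicator vector of a bundle. -/
def indZ {m : ℕ} (x : Finset (Fin m)) : Fin m → ℤ := fun j => if j ∈ x then 1 else 0

/-- Integer matrix whose rows are the indicator vectors of the bundles `y l`. -/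
def WmatZ {m k : ℕ} (y : Fin k → Finset (Fin m)) : Matrix (Fin k) (Fin m) ℤ :=
  fun l j => if j ∈ y l then 1 else 0

/-- Feasible allocations: each item is allocated to at most one bidder. -/
def Feasible {n m : ℕ} (a : Fin n → Finset (Fin m)) : Prop :=
  ∀ j : Fin m, (∑ i, if j ∈ a i then (1 : ℕ) else 0) ≤ 1

/-- The k-Fourier-sparse WHT approximation ṽ(x) = ⟨φ, (−1)^{W x}⟩. -/
def vWHT {m k : ℕ} (y : Fin k → Finset (Fin m)) (φ : Fin k → ℝ)
    (x : Finset (Fin m)) : ℝ :=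
  ∑ l, φ l * (-1 : ℝ) ^ ((WmatZ y).mulVec (indZ x) l)

/-- The WHT MIP constraints: α = −2β + 1, β ∈ {0,1}^k, β = W a − 2γ, γ ∈ ℤ^k. -/
def ConstrWHT {n m k : ℕ} (y : Fin n → Fin k → Finset (Fin m))
    (a : Fin n → Finset (Fin m)) (α : Fin n → Fin k → ℝ)
    (β γ : Fin n → Fin k → ℤ) : Prop :=
  ∀ i, (∀ l, β i l = 0 ∨ β i l = 1) ∧
    (∀ l, α i l = -2 * (β i l : ℝ) + 1) ∧
    (∀ l, β i l = (WmatZ (y i)).mulVec (indZ (a i)) l - 2 * γ i l)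

/-- The sign of an integer is the affine image of its residue modulo two. -/
theorem neg_one_zpow_eq_of_bit {z b g : ℤ} (hb : b = 0 ∨ b = 1) (h : b = z - 2 * g) :
    (-1 : ℝ) ^ z = -2 * (b : ℝ) + 1 := by
  obtain rfl : z = b + 2 * g := by omega
  rw [zpow_add₀ (by norm_num), _root_.zpow_mul]
  rcases hb with rfl | rfl <;> norm_num

/-- Every allocation extends to a solution of the constraints. -/
theorem exists_constrWHT {n m k : ℕ} (y : Fin n → Fin k → Finset (Fin m))
    (a : Fin n → Finset (Fin m)) : ∃ α β γ, ConstrWHT y a α β γ := by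
  refine ⟨fun i l => -2 * (((WmatZ (y i)).mulVec (indZ (a i)) l % 2 : ℤ) : ℝ) + 1,
    fun i l => (WmatZ (y i)).mulVec (indZ (a i)) l % 2,
    fun i l => (WmatZ (y i)).mulVec (indZ (a i)) l / 2,
    fun i => ⟨fun l => Int.emod_two_eq_zero_or_one _, fun l => rfl, fun l => ?_⟩⟩
  dsimp only
  omega

/-- Every solution of the constraints attains the value of the WHT approximation. -/
theorem ConstrWHT.sum_eq_vWHT {n m k : ℕ} {y : Fin n → Fin k → Finset (Fin m)}
    {a : Fin n → Finset (Fin m)} {α : Fin n → Fin k → ℝ} {β γ : Fin n → Fin k → ℤ}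
    (h : ConstrWHT y a α β γ) (φ : Fin n → Fin k → ℝ) (i : Fin n) :
    ∑ l, φ i l * α i l = vWHT (y i) (φ i) (a i) := by
  obtain ⟨hβ, hα, hγ⟩ := h i
  refine Finset.sum_congr rfl fun l _ => ?_
  rw [hα l, neg_one_zpow_eq_of_bit (hβ l) (hγ l)]

/-- WHT-based MIP is equivalent to the WHT-based winner determination problem. -/
theorem wht_mip (n m k : ℕ) (hn : 0 < n) (hm : 0 < m) (hk : 0 < k)
    (y : Fin n → Fin k → Finset (Fin m)) (hy : ∀ i, Function.Injective (y i))
    (φ : Fin n → Fin k → ℝ) :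
    (∀ a, Feasible a → ∃ α β γ, ConstrWHT y a α β γ) ∧
    (∀ a, Feasible a → ∀ α β γ, ConstrWHT y a α β γ →
      ∀ i, (∑ l, φ i l * α i l) = vWHT (y i) (φ i) (a i)) ∧
    (∀ a, Feasible a →
      ((∀ a', Feasible a' →
          (∑ i, vWHT (y i) (φ i) (a' i)) ≤ ∑ i, vWHT (y i) (φ i) (a i))
        ↔ (∃ α β γ, ConstrWHT y a α β γ ∧
            ∀ a' α' β' γ', Feasible a' → ConstrWHT y a' α' β' γ' →
              (∑ i, ∑ l, φ i l * α' i l) ≤ ∑ i, ∑ l, φ i l * α i l))) := by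
  refine ⟨fun a _ => exists_constrWHT y a, fun a _ α β γ h i => h.sum_eq_vWHT φ i,
    fun a _ => ⟨fun hmax => ?_, ?_⟩⟩
  · obtain ⟨α, β, γ, h⟩ := exists_constrWHT y a
    refine ⟨α, β, γ, h, fun a' α' β' γ' ha' h' => ?_⟩
    simpa only [h.sum_eq_vWHT, h'.sum_eq_vWHT] using hmax a' ha'
  · rintro ⟨α, β, γ, h, hmax⟩ a' ha'
    obtain ⟨α', β', γ', h'⟩ := exists_constrWHT y a'
    simpa only [h.sum_eq_vWHT, h'.sum_eq_vWHT] using hmax a' α' β' γ' ha' h'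
end
end

section
/- (FT4 sampling theorem) Let m be a positive integer and let S ⊆ {0,1}^m be any nonempty finite set of bundles. Let S' = {1_m − y : y ∈ S} and index the rows of a matrix M by S' and the columns by S, with entries M_{x,y} = 𝟙[min(x,y) = 0_m] for x ∈ S', y ∈ S. Then M is invertible over ℝ. -/
/-- A square matrix over a field, indexed by a finite partial order, is invertible if it is
lower triangular for this order and has no zero on the diagonal. -/
theorem isUnit_of_lowerTriangular_partialOrder {ι K : Type*} [Fintype ι] [DecidableEq ι]
    [PartialOrder ι] [Field K] (A : Matrix ι ι K) (hlow : ∀ i j, ¬ j ≤ i → A i j = 0)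
    (hdiag : ∀ i, A i i ≠ 0) : IsUnit A := by
  rw [← Matrix.mulVec_injective_iff_isUnit]
  refine (injective_iff_map_eq_zero A.mulVecLin).2 fun v hv => ?_
  have hrow (i : ι) : ∑ j, A i j * v j = 0 := congrFun hv i
  funext i
  induction i using WellFoundedLT.induction with
  | ind i ih =>
    have hi := hrow i
    rw [Finset.sum_eq_single i] at hi
    · exact (mul_eq_zero.1 hi).resolve_left (hdiag i)
    · intro j _ hji
      by_cases hle : j ≤ i
      · rw [ih j (lt_of_le_of_ne hle hji), Pi.zero_apply, mul_zero]
      · rw [hlow i j hle, zero_mul]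
    · exact fun h => absurd (Finset.mem_univ i) h

/-- FT4 sampling theorem: for any nonempty set S of bundles, the matrix with
rows indexed by the complements S' = {1_m − y : y ∈ S} (the row for y ∈ S being
the row 1_m − y of the inverse FT4 matrix) and columns indexed by S, with
entries 𝟙[min(1_m − x, y) = 0_m], is invertible over ℝ. -/
theorem ft4_sampling (m : ℕ) (hm : 0 < m)
    (S : Finset (Finset (Fin m))) (hS : S.Nonempty)
    (M : Matrix {x // x ∈ S} {y // y ∈ S} ℝ)
    (hM : ∀ x y, M x y =
      if (Finset.univ \ (x : Finset (Fin m))) ∩ (y : Finset (Fin m)) = ∅ then 1 else 0) :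
    IsUnit M := by
  have hsub (x y : {x // x ∈ S}) :
      (Finset.univ \ (x : Finset (Fin m))) ∩ (y : Finset (Fin m)) = ∅ ↔ y ≤ x := by
    rw [← Finset.disjoint_iff_inter_eq_empty, ← Finset.compl_eq_univ_sdiff,
      disjoint_comm, ← le_compl_iff_disjoint_right, compl_compl, Subtype.coe_le_coe]
  refine isUnit_of_lowerTriangular_partialOrder M (fun x y hxy => ?_) (fun x => ?_)
  · rw [hM, if_neg (mt (hsub x y).1 hxy)]
  · rw [hM, if_pos ((hsub x x).2 le_rfl)]
    exact one_ne_zero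
end

section
/- (Sparse FT3 recovery from samples) Let m be a positive integer and S ⊆ {0,1}^m a nonempty finite set. Suppose φ, ψ : {0,1}^m → ℝ are two coefficient functions supported in S (i.e., φ(y) = ψ(y) = 0 for y ∉ S), and suppose the corresponding FT3-sparse set functions agree on S, i.e., Σ_{y ∈ S} 𝟙[min(x,y) = y] φ(y) = Σ_{y ∈ S} 𝟙[min(x,y) = y] ψ(y) for every x ∈ S. Then φ = ψ, and hence the two set functions v(x) = Σ_{y} 𝟙[min(x,y)=y] φ(y) and w(x) = Σ_{y} 𝟙[min(x,y)=y] ψ(y) agree on all of {0,1}^m. In other words, a set function whose FT3 Fourier support is contained in S is uniquely determined by its values on the sample set S. -/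
/-- A function on a finite family of sets is determined by its sums over the members of the family
contained in each member of the family. -/
theorem eqOn_of_sum_subset_eq {α R : Type*} [DecidableEq α] [Ring R]
    {S : Finset (Finset α)} {φ ψ : Finset α → R}
    (hagree : ∀ x ∈ S,
      (∑ y ∈ S, (if y ⊆ x then (1 : R) else 0) * φ y)
        = ∑ y ∈ S, (if y ⊆ x then (1 : R) else 0) * ψ y) :
    ∀ x ∈ S, φ x = ψ x := by
  intro x
  induction x using Finset.strongInduction with
  | H x ih =>
    intro hx
    have h := hagree x hx
    rw [← Finset.add_sum_erase S _ hx, ← Finset.add_sum_erase S _ hx] at h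
    have hrest : ∑ y ∈ S.erase x, (if y ⊆ x then (1 : R) else 0) * φ y
        = ∑ y ∈ S.erase x, (if y ⊆ x then (1 : R) else 0) * ψ y := by
      refine Finset.sum_congr rfl fun y hy => ?_
      obtain ⟨hne, hyS⟩ := Finset.mem_erase.mp hy
      by_cases hyx : y ⊆ x
      · rw [ih y (hyx.ssubset_of_ne hne) hyS]
      · simp [hyx]
    rw [hrest] at h
    simpa using h


/-- Sparse FT3 recovery from samples: a set function whose FT3 Fourier support
is contained in S is uniquely determined by its values on the sample set S. -/
theorem ft3_sparse_recovery (m : ℕ) (hm : 0 < m)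
    (S : Finset (Finset (Fin m))) (hS : S.Nonempty)
    (φ ψ : Finset (Fin m) → ℝ)
    (hφ : ∀ y ∉ S, φ y = 0) (hψ : ∀ y ∉ S, ψ y = 0)
    (hagree : ∀ x ∈ S,
      (∑ y ∈ S, (if y ⊆ x then (1 : ℝ) else 0) * φ y)
        = ∑ y ∈ S, (if y ⊆ x then (1 : ℝ) else 0) * ψ y) :
    φ = ψ ∧ ∀ x : Finset (Fin m),
      (∑ y : Finset (Fin m), (if y ⊆ x then (1 : ℝ) else 0) * φ y)
        = ∑ y : Finset (Fin m), (if y ⊆ x then (1 : ℝ) else 0) * ψ y := by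
  have h : φ = ψ := by
    funext y
    by_cases hy : y ∈ S
    · exact eqOn_of_sum_subset_eq hagree y hy
    · rw [hφ y hy, hψ y hy]
  exact ⟨h, fun x => by rw [h]⟩
end
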